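/- arXiv:1207.0775 — 2 statements merged into one kernel-verified Lean document; each statement's English description precedes it below -/
import Mathlib

section
/- Let σ ∈ [0,1). If x ∈ ℝ^n is not a critical Pareto point of F and v is a σ-approximate steepest descent direction at x, then v is a descent direction for F at x, i.e., ⟨∇f_i(x), v⟩ < 0 for all i = 1,…,m. -/
open scoped Classical

noncomputable section

/-- `ℝ^n` as a Euclidean space. -/
abbrev E (n : ℕ) := EuclideanSpace ℝ (Fin n)

/-- The objective of the steepest-descent direction subproblem:
`v ↦ max_{1≤i≤m} ⟨∇f_i(x), v⟩ + (1/2)‖v‖²`. -/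
def phi {n m : ℕ} (f : Fin m → E n → ℝ) (x v : E n) : ℝ :=
  (⨆ i, (inner ℝ (gradient (f i) x) v : ℝ)) + (1 / 2) * ‖v‖ ^ 2

/-- `x` is a critical Pareto point: no direction `v` has `⟨∇f_i(x), v⟩ < 0` for all `i`. -/
def IsParetoCritical {n m : ℕ} (f : Fin m → E n → ℝ) (x : E n) : Prop :=
  ¬ ∃ v : E n, ∀ i, (inner ℝ (gradient (f i) x) v : ℝ) < 0

/-- Scaling a common descent direction suitably makes the subproblem objective negative. -/
theorem exists_phi_neg {n m : ℕ} (hm : 0 < m) (f : Fin m → E n → ℝ) (x w : E n)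
    (hw : ∀ i, (inner ℝ (gradient (f i) x) w : ℝ) < 0) : ∃ u : E n, phi f x u < 0 := by
  have : Nonempty (Fin m) := ⟨⟨0, hm⟩⟩
  obtain ⟨j, hj⟩ := exists_eq_ciSup_of_finite (f := fun i => (inner ℝ (gradient (f i) x) w : ℝ))
  have hM := hw j
  set M : ℝ := inner ℝ (gradient (f j) x) w
  have hW : 0 < ‖w‖ ^ 2 + 1 := by positivity
  have ht : 0 < -M / (‖w‖ ^ 2 + 1) := div_pos (neg_pos.mpr hM) hW
  obtain ⟨t, htdef⟩ : ∃ t, t = -M / (‖w‖ ^ 2 + 1) := ⟨_, rfl⟩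
  rw [← htdef] at ht
  have htM : t * (‖w‖ ^ 2 + 1) = -M := by rw [htdef, div_mul_cancel₀ _ hW.ne']
  refine ⟨t • w, ?_⟩
  have hsup : (⨆ i, (inner ℝ (gradient (f i) x) (t • w) : ℝ)) ≤ t * M := by
    refine ciSup_le fun i => ?_
    rw [real_inner_smul_right, hj]
    exact mul_le_mul_of_nonneg_left
      (le_ciSup (f := fun i => (inner ℝ (gradient (f i) x) w : ℝ))
        (Set.finite_range _).bddAbove i) ht.le
  have hnorm : ‖t • w‖ ^ 2 = t ^ 2 * ‖w‖ ^ 2 := by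
    rw [norm_smul, mul_pow, Real.norm_eq_abs, sq_abs]
  unfold phi
  rw [hnorm]
  have hMt : t * M = -(t ^ 2 * (‖w‖ ^ 2 + 1)) := by linear_combination t * htM
  have h1 : 0 < t ^ 2 := by positivity
  have h2 : 0 ≤ t ^ 2 * ‖w‖ ^ 2 := by positivity
  linarith

theorem stmt_6 {n m : ℕ} (hm : 0 < m) (f : Fin m → E n → ℝ)
    (hf : ∀ i, ContDiff ℝ 1 (f i)) (x : E n)
    (σ : ℝ) (hσ0 : 0 ≤ σ) (hσ1 : σ < 1)
    (hx : ¬ IsParetoCritical f x)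
    (vx : E n) (hmin : ∀ u : E n, phi f x vx ≤ phi f x u)
    (v : E n) (happrox : phi f x v ≤ (1 - σ) * phi f x vx) :
    ∀ i, (inner ℝ (gradient (f i) x) v : ℝ) < 0 := by
  intro i
  obtain ⟨w, hw⟩ := not_not.mp hx
  obtain ⟨u, hu⟩ := exists_phi_neg hm f x w hw
  have hneg : phi f x v < 0 :=
    happrox.trans_lt (mul_neg_of_pos_of_neg (sub_pos.mpr hσ1) ((hmin u).trans_lt hu))
  have hle : (inner ℝ (gradient (f i) x) v : ℝ) ≤ ⨆ i, (inner ℝ (gradient (f i) x) v : ℝ) :=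
    le_ciSup (f := fun i => (inner ℝ (gradient (f i) x) v : ℝ)) (Set.finite_range _).bddAbove i
  unfold phi at hneg
  linarith [sq_nonneg ‖v‖]
end
end

section
/- Suppose F is quasi-convex, {x^k}, {v^k}, {t_k} are generated by the inexact steepest descent method with Armijo rule, for every k there exists w^k in the unit simplex (w^k_i ≥ 0, Σ_{i=1}^m w^k_i = 1) with v^k = −Σ_{i=1}^m w^k_i ∇f_i(x^k), and the set U := { x ∈ ℝ^n : F(x) ⪯ F(x^k) for all k } is nonempty. Then the sequence {x^k} converges to a critical Pareto point of F. -/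
open scoped Classical Topology

noncomputable section

/-- The optimal value `α(x)` of the steepest-descent direction subproblem. -/
def alphaVal {n m : ℕ} (f : Fin m → E n → ℝ) (x : E n) : ℝ :=
  ⨅ v : E n, phi f x v

/-- The set of candidate Armijo step sizes `2^{-j}` at `x` in direction `v`. -/
def ArmijoSet {n m : ℕ} (f : Fin m → E n → ℝ) (β : ℝ) (x v : E n) : Set ℝ :=
  {s : ℝ | ∃ j : ℕ, s = (2 : ℝ) ^ (-(j : ℤ)) ∧
    ∀ i, f i (x + s • v) ≤ f i x + β * s * (inner ℝ (gradient (f i) x) v : ℝ)}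

/-- The inexact steepest descent method with Armijo rule: at each iteration `k`,
`x k` is not a critical Pareto point, `v k` is a `σ`-approximate steepest descent
direction at `x k`, `t k` is the largest Armijo step size `2^{-j}`, and
`x (k+1) = x k + t k • v k`. -/
structure IsInexactSDMethod {n m : ℕ} (f : Fin m → E n → ℝ) (β σ : ℝ)
    (x v : ℕ → E n) (t : ℕ → ℝ) : Prop where
  hβ0 : 0 < β
  hβ1 : β < 1
  hσ0 : 0 ≤ σ
  hσ1 : σ < 1
  not_crit : ∀ k, ¬ IsParetoCritical f (x k)
  approx : ∀ k, phi f (x k) (v k) ≤ (1 - σ) * alphaVal f (x k)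
  step_mem : ∀ k, t k ∈ ArmijoSet f β (x k) (v k)
  step_max : ∀ k, ∀ s ∈ ArmijoSet f β (x k) (v k), s ≤ t k
  update : ∀ k, x (k + 1) = x k + t k • v k

/-- A vector function (given by its components) is quasi-convex if
`F((1-t)x + ty) ⪯ max{F(x), F(y)}` coordinatewise for all `t ∈ [0,1]`. -/
def VecQuasiConvex {n m : ℕ} (f : Fin m → E n → ℝ) : Prop :=
  ∀ x y : E n, ∀ t ∈ Set.Icc (0 : ℝ) 1, ∀ i,
    f i ((1 - t) • x + t • y) ≤ max (f i x) (f i y)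

section Auxiliary

open Filter Set

theorem inner_gradient_sub_nonpos_of_quasiconvex {n : ℕ} {g : E n → ℝ} (hg : Differentiable ℝ g)
    {a b : E n} (hqc : ∀ t ∈ Icc (0 : ℝ) 1, g ((1 - t) • a + t • b) ≤ max (g a) (g b))
    (hab : g b ≤ g a) : (inner ℝ (gradient g a) (b - a) : ℝ) ≤ 0 := by
  rw [inner_gradient_left]
  have hline : HasLineDerivAt ℝ g (fderiv ℝ g a (b - a)) a (b - a) :=
    (hg a).hasFDerivAt.hasLineDerivAt (b - a)
  refine le_of_tendsto hline.tendsto_slope_zero_right ?_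
  filter_upwards [Ioc_mem_nhdsGT (zero_lt_one' ℝ)] with t ht
  have h := hqc t ⟨ht.1.le, ht.2⟩
  rw [max_eq_left hab, show (1 - t) • a + t • b = a + t • (b - a) by module] at h
  exact mul_nonpos_of_nonneg_of_nonpos (inv_nonneg.2 ht.1.le) (sub_nonpos.2 h)

theorem exists_mem_segment_inner_gradient_eq {n : ℕ} {g : E n → ℝ} (hg : Differentiable ℝ g)
    (a u : E n) :
    ∃ z ∈ segment ℝ a (a + u), g (a + u) - g a = (inner ℝ (gradient g z) u : ℝ) := by
  obtain ⟨z, hz, h⟩ := domain_mvt (f := g) (s := univ) (x := a) (y := a + u)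
    (fun y _ => (hg y).hasFDerivAt.hasFDerivWithinAt) convex_univ trivial trivial
  exact ⟨z, hz, by rw [h, inner_gradient_left, add_sub_cancel_left]⟩

theorem continuous_gradient_of_contDiff {n : ℕ} {g : E n → ℝ} (hg : ContDiff ℝ 1 g) :
    Continuous (gradient g) :=
  (InnerProductSpace.toDual ℝ (E n)).symm.continuous.comp (hg.continuous_fderiv one_ne_zero)

/-- A quasi-Fejér sequence of nonnegative numbers with a subsequence tending to zero
tends to zero. -/
theorem tendsto_zero_of_quasiFejer {a e : ℕ → ℝ} (ha : ∀ k, 0 ≤ a k)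
    (he0 : ∀ k, 0 ≤ e k) (he : Summable e) (hstep : ∀ k, a (k + 1) ≤ a k + e k)
    {ψ : ℕ → ℕ} (hψ : StrictMono ψ) (hsub : Tendsto (a ∘ ψ) atTop (𝓝 0)) :
    Tendsto a atTop (𝓝 0) := by
  set S : ℕ → ℝ := fun k => ∑ j ∈ Finset.range k, e j with hS
  have hanti : Antitone fun k => a k - S k := antitone_nat_of_succ_le fun k => by
    simp only [hS, Finset.sum_range_succ]
    linarith [hstep k]
  have hbdd : BddBelow (range fun k => a k - S k) := by
    refine ⟨-∑' j, e j, ?_⟩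
    rintro _ ⟨k, rfl⟩
    have := he.sum_le_tsum (Finset.range k) fun j _ => he0 j
    simp only [hS]
    linarith [ha k]
  have hlim := (tendsto_atTop_ciInf hanti hbdd).add he.hasSum.tendsto_sum_nat
  simp only [hS, sub_add_cancel] at hlim
  rwa [← tendsto_nhds_unique (hlim.comp hψ.tendsto_atTop) hsub]

section Subproblem

variable {n m : ℕ} (f : Fin m → E n → ℝ)

theorem inner_gradient_add_le_phi (y u : E n) (i : Fin m) :
    (inner ℝ (gradient (f i) y) u : ℝ) + (1 / 2) * ‖u‖ ^ 2 ≤ phi f y u :=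
  add_le_add_left (le_ciSup (f := fun i => (inner ℝ (gradient (f i) y) u : ℝ))
    (Set.finite_range _).bddAbove i) _

variable [NeZero m]

theorem alphaVal_le_phi (y u : E n) : alphaVal f y ≤ phi f y u := by
  refine ciInf_le ⟨-(1 / 2) * ‖gradient (f 0) y‖ ^ 2, ?_⟩ u
  rintro _ ⟨w, rfl⟩
  refine le_trans ?_ (inner_gradient_add_le_phi f y w 0)
  have h := norm_add_sq_real (gradient (f 0) y) w
  nlinarith [sq_nonneg ‖gradient (f 0) y + w‖]

theorem alphaVal_nonpos (y : E n) : alphaVal f y ≤ 0 :=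
  (alphaVal_le_phi f y 0).trans_eq (by simp [phi])

/-- Near a point which is not Pareto critical, the optimal value of the subproblem is bounded
away from zero. -/
theorem exists_eventually_alphaVal_le (hf : ∀ i, ContDiff ℝ 1 (f i)) {p : E n}
    (hp : ¬ IsParetoCritical f p) : ∃ δ > 0, ∀ᶠ y in 𝓝 p, alphaVal f y ≤ -δ := by
  obtain ⟨d, hd⟩ := not_not.1 hp
  obtain ⟨i₀, hi₀⟩ := Finite.exists_max fun i => (inner ℝ (gradient (f i) p) d : ℝ)
  obtain ⟨c, hc⟩ : ∃ c, c = -(inner ℝ (gradient (f i₀) p) d : ℝ) / 2 := ⟨_, rfl⟩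
  have hc0 : 0 < c := by linarith [hd i₀]
  have hnear : ∀ᶠ y in 𝓝 p, ∀ i, (inner ℝ (gradient (f i) y) d : ℝ) < -c := by
    refine eventually_all.2 fun i => ?_
    have hcont : Continuous fun y => (inner ℝ (gradient (f i) y) d : ℝ) :=
      (continuous_gradient_of_contDiff (hf i)).inner continuous_const
    exact hcont.continuousAt.eventually_lt_const (by linarith [hi₀ i])
  obtain ⟨D, hD⟩ : ∃ D, D = ‖d‖ ^ 2 := ⟨_, rfl⟩
  have hD0 : 0 ≤ D := hD ▸ sq_nonneg _
  obtain ⟨s, hs⟩ : ∃ s, s = c / (D + 1) := ⟨_, rfl⟩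
  have hs0 : 0 < s := by rw [hs]; positivity
  have hsc : s * (D + 1) = c := by rw [hs]; field_simp
  refine ⟨s * c / 2, by positivity, ?_⟩
  filter_upwards [hnear] with y hy
  refine (alphaVal_le_phi f y (s • d)).trans ?_
  have hsup : (⨆ i, (inner ℝ (gradient (f i) y) (s • d) : ℝ)) ≤ s * -c := ciSup_le fun i => by
    rw [real_inner_smul_right]
    exact mul_le_mul_of_nonneg_left (hy i).le hs0.le
  have hnorm : ‖s • d‖ ^ 2 = s ^ 2 * D := by
    rw [norm_smul, mul_pow, Real.norm_eq_abs, sq_abs, hD]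
  rw [phi, hnorm]
  have : s ^ 2 * D ≤ s * c := by rw [← hsc]; nlinarith [sq_nonneg s]
  linarith

end Subproblem

namespace IsInexactSDMethod

variable {n m : ℕ} {f : Fin m → E n → ℝ} {β σ : ℝ} {x v : ℕ → E n} {t : ℕ → ℝ}

theorem step_pos (h : IsInexactSDMethod f β σ x v t) (k : ℕ) : 0 < t k := by
  obtain ⟨j, hj, -⟩ := h.step_mem k
  rw [hj]
  positivity

theorem step_le_one (h : IsInexactSDMethod f β σ x v t) (k : ℕ) : t k ≤ 1 := by
  obtain ⟨j, hj, -⟩ := h.step_mem k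
  rw [hj]
  exact zpow_le_one_of_nonpos₀ one_le_two (by simp)

theorem apply_succ_le (h : IsInexactSDMethod f β σ x v t) (k : ℕ) (i : Fin m) :
    f i (x (k + 1)) ≤ f i (x k) + β * t k * (inner ℝ (gradient (f i) (x k)) (v k) : ℝ) := by
  obtain ⟨j, -, hj⟩ := h.step_mem k
  rw [h.update k]
  exact hj i

theorem inner_gradient_add_le (h : IsInexactSDMethod f β σ x v t) (k : ℕ) (i : Fin m) :
    (inner ℝ (gradient (f i) (x k)) (v k) : ℝ) + (1 / 2) * ‖v k‖ ^ 2
      ≤ (1 - σ) * alphaVal f (x k) :=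
  (inner_gradient_add_le_phi f (x k) (v k) i).trans (h.approx k)

/-- The iterates are quasi-Fejér convergent to the set of points dominating all of them. -/
theorem norm_sub_sq_succ_le (h : IsInexactSDMethod f β σ x v t)
    (hf : ∀ i, ContDiff ℝ 1 (f i)) (hqc : VecQuasiConvex f)
    (hscal : ∀ k, ∃ w : Fin m → ℝ, (∀ i, 0 ≤ w i) ∧ (∑ i, w i) = 1 ∧
      v k = -∑ i, w i • gradient (f i) (x k))
    {q : E n} (hq : ∀ k i, f i q ≤ f i (x k)) (k : ℕ) :
    ‖x (k + 1) - q‖ ^ 2 ≤ ‖x k - q‖ ^ 2 + t k * ‖v k‖ ^ 2 := by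
  obtain ⟨w, hw, -, hv⟩ := hscal k
  have hinner : (inner ℝ (x k - q) (v k) : ℝ) ≤ 0 := by
    have h₁ : (inner ℝ (x k - q) (v k) : ℝ)
        = ∑ i, w i * (inner ℝ (gradient (f i) (x k)) (q - x k) : ℝ) := by
      rw [hv, ← neg_sub q, inner_neg_neg, inner_sum]
      refine Finset.sum_congr rfl fun i _ => ?_
      rw [real_inner_smul_right, real_inner_comm]
    rw [h₁]
    exact Finset.sum_nonpos fun i _ => mul_nonpos_of_nonneg_of_nonpos (hw i)
      (inner_gradient_sub_nonpos_of_quasiconvex ((hf i).differentiable one_ne_zero)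
        (fun s hs => hqc (x k) q s hs i) (hq k i))
  have hexp := norm_add_sq_real (x k - q) (t k • v k)
  rw [real_inner_smul_right, norm_smul, mul_pow, Real.norm_eq_abs, sq_abs,
    show x k - q + t k • v k = x (k + 1) - q by rw [h.update k]; abel] at hexp
  have h₁ := mul_nonpos_of_nonneg_of_nonpos (h.step_pos k).le hinner
  have h₂ : t k ^ 2 * ‖v k‖ ^ 2 ≤ t k * ‖v k‖ ^ 2 :=
    mul_le_mul_of_nonneg_right (by nlinarith [h.step_pos k, h.step_le_one k]) (sq_nonneg _)
  linarith

variable [NeZero m]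

theorem inner_gradient_le (h : IsInexactSDMethod f β σ x v t) (k : ℕ) (i : Fin m) :
    (inner ℝ (gradient (f i) (x k)) (v k) : ℝ) ≤ -(1 / 2) * ‖v k‖ ^ 2 := by
  have := mul_nonpos_of_nonneg_of_nonpos (sub_nonneg.2 h.hσ1.le) (alphaVal_nonpos f (x k))
  linarith [h.inner_gradient_add_le k i]

theorem norm_direction_le (h : IsInexactSDMethod f β σ x v t) (k : ℕ) (i : Fin m) :
    ‖v k‖ ≤ 2 * ‖gradient (f i) (x k)‖ := by
  have h₁ := h.inner_gradient_le k i
  have h₂ := neg_le_of_abs_le (abs_real_inner_le_norm (gradient (f i) (x k)) (v k))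
  by_contra! hlt
  have hpos : 0 < ‖v k‖ := (by positivity : (0 : ℝ) ≤ _).trans_lt hlt
  nlinarith

theorem antitone_apply (h : IsInexactSDMethod f β σ x v t) (i : Fin m) :
    Antitone fun k => f i (x k) := antitone_nat_of_succ_le fun k => by
  have h₁ : (inner ℝ (gradient (f i) (x k)) (v k) : ℝ) ≤ 0 :=
    (h.inner_gradient_le k i).trans (by nlinarith [sq_nonneg ‖v k‖])
  have h₂ := mul_nonpos_of_nonneg_of_nonpos (mul_pos h.hβ0 (h.step_pos k)).le h₁
  linarith [h.apply_succ_le k i]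

theorem summable_step_mul_norm_sq (h : IsInexactSDMethod f β σ x v t)
    {q : E n} (hq : ∀ k i, f i q ≤ f i (x k)) : Summable fun k => t k * ‖v k‖ ^ 2 := by
  have hβ := h.hβ0
  have hbound : ∀ k, t k * ‖v k‖ ^ 2 ≤ 2 / β * (f 0 (x k) - f 0 (x (k + 1))) := fun k => by
    rw [div_mul_eq_mul_div, le_div_iff₀ hβ]
    have := mul_le_mul_of_nonneg_left (h.inner_gradient_le k 0) (mul_pos hβ (h.step_pos k)).le
    linarith [h.apply_succ_le k 0]
  refine summable_of_sum_range_le (c := 2 / β * (f 0 (x 0) - f 0 q))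
    (fun k => mul_nonneg (h.step_pos k).le (sq_nonneg _)) fun N => ?_
  refine (Finset.sum_le_sum fun k _ => hbound k).trans ?_
  rw [← Finset.mul_sum, Finset.sum_range_sub']
  exact mul_le_mul_of_nonneg_left (by linarith [hq N 0]) (by positivity)

theorem exists_tendsto (h : IsInexactSDMethod f β σ x v t)
    (hf : ∀ i, ContDiff ℝ 1 (f i)) (hqc : VecQuasiConvex f)
    (hscal : ∀ k, ∃ w : Fin m → ℝ, (∀ i, 0 ≤ w i) ∧ (∑ i, w i) = 1 ∧
      v k = -∑ i, w i • gradient (f i) (x k))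
    {q : E n} (hq : ∀ k i, f i q ≤ f i (x k)) : ∃ p, Tendsto x atTop (𝓝 p) := by
  have hsum := h.summable_step_mul_norm_sq hq
  have he0 : ∀ k, 0 ≤ t k * ‖v k‖ ^ 2 := fun k => mul_nonneg (h.step_pos k).le (sq_nonneg _)
  obtain ⟨C, hC⟩ : ∃ C, C = ‖x 0 - q‖ ^ 2 + ∑' k, t k * ‖v k‖ ^ 2 := ⟨_, rfl⟩
  have hbound : ∀ k, ‖x k - q‖ ^ 2 ≤ C := fun k => by
    have hk : ‖x k - q‖ ^ 2 ≤ ‖x 0 - q‖ ^ 2 + ∑ j ∈ Finset.range k, t j * ‖v j‖ ^ 2 := by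
      induction k with
      | zero => simp
      | succ k ih =>
        rw [Finset.sum_range_succ]
        linarith [h.norm_sub_sq_succ_le hf hqc hscal hq k]
    linarith [hsum.sum_le_tsum (Finset.range k) fun j _ => he0 j]
  obtain ⟨p, -, ψ, hψ, hp⟩ := tendsto_subseq_of_bounded (Metric.isBounded_closedBall (x := q)
    (r := √C)) (x := x) fun k => by
      rw [mem_closedBall_iff_norm]
      exact Real.le_sqrt_of_sq_le (hbound k)
  have hpx : ∀ k i, f i p ≤ f i (x k) := fun k i => by
    refine le_of_tendsto (((hf i).continuous.tendsto p).comp hp) ?_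
    filter_upwards [eventually_ge_atTop k] with l hl
    exact h.antitone_apply i (hl.trans (hψ.id_le l))
  have hsub : Tendsto ((fun k => ‖x k - p‖ ^ 2) ∘ ψ) atTop (𝓝 0) := by
    simpa [Function.comp_def] using (tendsto_iff_norm_sub_tendsto_zero.1 hp).pow 2
  have hsq := tendsto_zero_of_quasiFejer (fun k => sq_nonneg _) he0 hsum
    (h.norm_sub_sq_succ_le hf hqc hscal hpx) hψ hsub
  refine ⟨p, tendsto_iff_norm_sub_tendsto_zero.2 ?_⟩
  simpa using hsq.sqrt

theorem isParetoCritical_of_tendsto (h : IsInexactSDMethod f β σ x v t)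
    (hf : ∀ i, ContDiff ℝ 1 (f i)) {p : E n} (hx : Tendsto x atTop (𝓝 p)) :
    IsParetoCritical f p := by
  by_contra hp
  have hβ := h.hβ0
  have hβ1 := h.hβ1
  have hcont := fun i => continuous_gradient_of_contDiff (hf i)
  obtain ⟨δ, hδ, hα⟩ := exists_eventually_alphaVal_le f hf hp
  obtain ⟨η, hη⟩ : ∃ η, η = (1 - σ) * δ := ⟨_, rfl⟩
  have hη0 : 0 < η := hη ▸ mul_pos (sub_pos.2 h.hσ1) hδ
  have hdesc : ∀ᶠ k in atTop, ∀ i, (inner ℝ (gradient (f i) (x k)) (v k) : ℝ) ≤ -η := by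
    filter_upwards [hx.eventually hα] with k hk i
    have := mul_le_mul_of_nonneg_left hk (sub_nonneg.2 h.hσ1.le)
    nlinarith [h.inner_gradient_add_le k i, sq_nonneg ‖v k‖]
  have hfx : Tendsto (fun k => f 0 (x k)) atTop (𝓝 (f 0 p)) :=
    ((hf 0).continuous.tendsto p).comp hx
  have ht : Tendsto t atTop (𝓝 0) := by
    have hdiff : Tendsto (fun k => (f 0 (x k) - f 0 (x (k + 1))) / (β * η)) atTop (𝓝 0) := by
      simpa using (hfx.sub ((tendsto_add_atTop_iff_nat 1).2 hfx)).div_const (β * η)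
    refine squeeze_zero' (Eventually.of_forall fun k => (h.step_pos k).le) ?_ hdiff
    filter_upwards [hdesc] with k hk
    rw [le_div_iff₀ (mul_pos hβ hη0)]
    have := mul_le_mul_of_nonneg_left (hk 0) (mul_pos hβ (h.step_pos k)).le
    linarith [h.apply_succ_le k 0]
  obtain ⟨M, hM⟩ : ∃ M, M = 2 * (‖gradient (f 0) p‖ + 1) := ⟨_, rfl⟩
  have hM0 : 0 < M := by rw [hM]; positivity
  have hvM : ∀ᶠ k in atTop, ‖v k‖ ≤ M := by
    filter_upwards [((((hcont 0).tendsto p).comp hx).norm).eventually_lt_const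
      (lt_add_one _)] with k hk
    rw [hM]
    exact (h.norm_direction_le k 0).trans (mul_le_mul_of_nonneg_left hk.le zero_le_two)
  have htv : Tendsto (fun k => (2 * t k) • v k) atTop (𝓝 0) := by
    refine squeeze_zero_norm' (a := fun k => 2 * t k * M) ?_
      (by simpa using (ht.const_mul 2).mul_const M)
    filter_upwards [hvM] with k hk
    have := h.step_pos k
    rw [norm_smul, Real.norm_of_nonneg (by positivity)]
    exact mul_le_mul_of_nonneg_left hk (by positivity)
  have hx' : Tendsto (fun k => x k + (2 * t k) • v k) atTop (𝓝 p) := by simpa using hx.add htv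
  obtain ⟨ε, hε⟩ : ∃ ε, ε = (1 - β) * η / (2 * M) := ⟨_, rfl⟩
  have hε0 : 0 < ε := by
    rw [hε]
    exact div_pos (mul_pos (sub_pos.2 hβ1) hη0) (by positivity)
  have hεM : 2 * ε * M = (1 - β) * η := by rw [hε]; field_simp
  have hball : ∀ᶠ y in 𝓝 p, ∀ i, ‖gradient (f i) y - gradient (f i) p‖ < ε :=
    eventually_all.2 fun i => by
      simpa [dist_eq_norm] using Metric.tendsto_nhds.1 ((hcont i).tendsto p) ε hε0
  obtain ⟨r, hr, hball⟩ := Metric.eventually_nhds_iff_ball.1 hball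
  obtain ⟨k, hk, htk, hvk, hxk, hxk'⟩ := (hdesc.and <|
    (ht.eventually_lt_const zero_lt_one).and <| hvM.and <|
    (hx.eventually_mem (Metric.ball_mem_nhds p hr)).and
    (hx'.eventually_mem (Metric.ball_mem_nhds p hr))).exists
  have htk0 := h.step_pos k
  have hnot : 2 * t k ∉ ArmijoSet f β (x k) (v k) := fun hmem => by
    linarith [h.step_max k _ hmem]
  obtain ⟨i, hi⟩ : ∃ i, f i (x k) + β * (2 * t k) * (inner ℝ (gradient (f i) (x k)) (v k) : ℝ)
      < f i (x k + (2 * t k) • v k) := by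
    by_contra! hall
    obtain ⟨j, hj, -⟩ := h.step_mem k
    cases j with
    | zero => simp [hj] at htk
    | succ j =>
      refine hnot ⟨j, ?_, hall⟩
      rw [hj, ← zpow_one_add₀ two_ne_zero]
      congr 1
      push_cast
      ring
  obtain ⟨z, hz, hfz⟩ := exists_mem_segment_inner_gradient_eq
    ((hf i).differentiable one_ne_zero) (x k) ((2 * t k) • v k)
  have hzb := hball z ((convex_ball p r).segment_subset hxk hxk' hz) i
  have hxb := hball (x k) hxk i
  rw [real_inner_smul_right] at hfz
  have hlt : β * (inner ℝ (gradient (f i) (x k)) (v k) : ℝ)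
      < (inner ℝ (gradient (f i) z) (v k) : ℝ) := by
    refine lt_of_mul_lt_mul_left ?_ (by positivity : 0 ≤ 2 * t k)
    linarith
  have hdist : ‖gradient (f i) z - gradient (f i) (x k)‖ < 2 * ε := by
    have := norm_sub_le (gradient (f i) z - gradient (f i) p)
      (gradient (f i) (x k) - gradient (f i) p)
    rw [sub_sub_sub_cancel_right] at this
    linarith
  have hcs := (real_inner_le_norm (gradient (f i) z - gradient (f i) (x k)) (v k)).trans
    (mul_le_mul hdist.le hvk (norm_nonneg _) (by positivity))
  rw [inner_sub_left, hεM] at hcs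
  have := mul_le_mul_of_nonneg_left (hk i) (sub_nonneg.2 hβ1.le)
  linarith

end IsInexactSDMethod

end Auxiliary

theorem stmt_19 {n m : ℕ} (hm : 0 < m) (f : Fin m → E n → ℝ)
    (hf : ∀ i, ContDiff ℝ 1 (f i)) (hqc : VecQuasiConvex f) (β σ : ℝ)
    (x v : ℕ → E n) (t : ℕ → ℝ)
    (hmethod : IsInexactSDMethod f β σ x v t)
    (hscal : ∀ k, ∃ w : Fin m → ℝ, (∀ i, 0 ≤ w i) ∧ (∑ i, w i) = 1 ∧
      v k = -∑ i, w i • gradient (f i) (x k))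
    (hU : ∃ xt : E n, ∀ k, ∀ i, f i xt ≤ f i (x k)) :
    ∃ p : E n, Filter.Tendsto x Filter.atTop (𝓝 p) ∧ IsParetoCritical f p := by
  have : NeZero m := ⟨hm.ne'⟩
  obtain ⟨q, hq⟩ := hU
  obtain ⟨p, hp⟩ := hmethod.exists_tendsto hf hqc hscal hq
  exact ⟨p, hp, hmethod.isParetoCritical_of_tendsto hf hp⟩
end
end
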